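/- Let α ∈ (0,1) and let λ_k^{(α)} be defined by λ₀^{(α)} = ((2+α)/2) g₀^{(α)} and λ_k^{(α)} = ((2+α)/2) g_k^{(α)} − (α/2) g_{k−1}^{(α)} for k ≥ 1, where g_k^{(α)} = (−1)^k (α choose k). Then for every positive integer k and every real vector (v₁,…,v_k), the quadratic form Σ_{n=0}^{k−1} ( Σ_{p=0}^{n} λ_p^{(α)} v_{n+1−p} ) v_{n+1} is nonnegative. -/

import Mathlib

/-- Grünwald coefficients `g_k^{(α)} = (-1)^k (α choose k)`. -/
noncomputable def grunwaldG (α : ℝ) (k : ℕ) : ℝ :=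
  (-1) ^ k * ((∏ i ∈ Finset.range k, (α - i)) / (k.factorial : ℝ))

/-- Weighted coefficients `λ_k^{(α)}`. -/
noncomputable def lamG (α : ℝ) : ℕ → ℝ
  | 0 => (2 + α) / 2 * grunwaldG α 0
  | k + 1 => (2 + α) / 2 * grunwaldG α (k + 1) - α / 2 * grunwaldG α k

lemma grunwaldG_zero (α : ℝ) : grunwaldG α 0 = 1 := by simp [grunwaldG]

lemma grunwaldG_succ (α : ℝ) (k : ℕ) :
    ((k : ℝ) + 1) * grunwaldG α (k + 1) = (k - α) * grunwaldG α k := by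
  have h1 : ((k : ℝ) + 1) ≠ 0 := by positivity
  have h2 : (k.factorial : ℝ) ≠ 0 := by positivity
  simp only [grunwaldG, Finset.prod_range_succ, Nat.factorial_succ, pow_succ]
  push_cast
  field_simp
  ring

lemma grunwaldG_succ_nonpos {α : ℝ} (hα : α ∈ Set.Ioo (0 : ℝ) 1) (k : ℕ) :
    grunwaldG α (k + 1) ≤ 0 := by
  obtain ⟨h0, h1⟩ := hα
  induction k with
  | zero =>
    have h := grunwaldG_succ α 0
    rw [grunwaldG_zero] at h
    norm_num at h ⊢
    linarith
  | succ k ih =>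
    have h := grunwaldG_succ α (k + 1)
    have hk : (0 : ℝ) ≤ k := k.cast_nonneg
    push_cast at h
    by_contra! hc
    nlinarith [mul_nonneg (show (0 : ℝ) ≤ k + 1 - α by linarith) (neg_nonneg.2 ih),
      mul_pos (show (0 : ℝ) < k + 1 + 1 by linarith) hc]

lemma sum_range_lamG (α : ℝ) (m : ℕ) :
    α * ∑ p ∈ Finset.range (m + 2), lamG α p
      = -grunwaldG α (m + 1) * (m + 1 - α - α ^ 2 / 2) := by
  induction m with
  | zero =>
    have h := grunwaldG_succ α 0
    simp only [grunwaldG_zero, Nat.cast_zero, zero_add] at h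
    have h1 : grunwaldG α 1 = -α := by linarith
    simp only [Finset.sum_range_succ, Finset.sum_range_zero, lamG, grunwaldG_zero, zero_add, h1,
      Nat.cast_zero]
    ring
  | succ m ih =>
    have h := grunwaldG_succ α (m + 1)
    rw [Finset.sum_range_succ, mul_add, ih]
    simp only [lamG]
    push_cast at h ⊢
    linear_combination h

lemma lamG_add_three_nonpos {α : ℝ} (hα : α ∈ Set.Ioo (0 : ℝ) 1) (k : ℕ) :
    lamG α (k + 3) ≤ 0 := by
  have h := grunwaldG_succ α (k + 2)
  have hg := grunwaldG_succ_nonpos hα (k + 1)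
  obtain ⟨h0, h1⟩ := hα
  have hk : (0 : ℝ) ≤ k := k.cast_nonneg
  push_cast at h
  have hc : 0 ≤ (2 + α) / 2 * (k + 2 - α) - α / 2 * (k + 3) := by nlinarith
  have he : ((k : ℝ) + 3) * lamG α (k + 3)
      = grunwaldG α (k + 2) * ((2 + α) / 2 * (k + 2 - α) - α / 2 * (k + 3)) := by
    simp only [lamG]
    linear_combination (2 + α) / 2 * h
  have hle : ((k : ℝ) + 3) * lamG α (k + 3) ≤ 0 := he ▸ mul_nonpos_of_nonpos_of_nonneg hg hc
  exact nonpos_of_mul_nonpos_right hle (by linarith)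

/-- The autocorrelation at lag `p` of a sequence supported in `{0, …, k - 1}`. -/
def autocorr (k : ℕ) (w : ℕ → ℝ) (p : ℕ) : ℝ :=
  ∑ n ∈ Finset.range k, w n * w (n + p)

lemma autocorr_le_autocorr_zero {k : ℕ} {w : ℕ → ℝ} (hw : ∀ n, k ≤ n → w n = 0) (p : ℕ) :
    autocorr k w p ≤ autocorr k w 0 := by
  have hshift : ∑ n ∈ Finset.range k, w (n + p) ^ 2 ≤ ∑ n ∈ Finset.range k, w n ^ 2 := by
    have h1 := Finset.sum_range_add (fun n => w n ^ 2) p k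
    have h2 := Finset.sum_range_add (fun n => w n ^ 2) k p
    have h3 : ∑ x ∈ Finset.range p, w (k + x) ^ 2 = 0 :=
      Finset.sum_eq_zero fun x _ => by simp [hw (k + x) (by omega)]
    have h4 : 0 ≤ ∑ n ∈ Finset.range p, w n ^ 2 := Finset.sum_nonneg fun _ _ => sq_nonneg _
    simp only [add_comm p] at h1
    linarith
  have hsq : 0 ≤ ∑ n ∈ Finset.range k, (w n - w (n + p)) ^ 2 :=
    Finset.sum_nonneg fun _ _ => sq_nonneg _
  have he : ∑ n ∈ Finset.range k, (w n - w (n + p)) ^ 2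
      = ∑ n ∈ Finset.range k, w n ^ 2 + ∑ n ∈ Finset.range k, w (n + p) ^ 2
        - 2 * autocorr k w p := by
    rw [autocorr, Finset.mul_sum, ← Finset.sum_add_distrib, ← Finset.sum_sub_distrib]
    exact Finset.sum_congr rfl fun _ _ => by ring
  have h0 : autocorr k w 0 = ∑ n ∈ Finset.range k, w n ^ 2 :=
    Finset.sum_congr rfl fun _ _ => by simp [sq]
  linarith

/-- Nonnegativity of the energy of second differences. -/
lemma autocorr_second_difference_nonneg {k : ℕ} {w : ℕ → ℝ} (hw : ∀ n, k ≤ n → w n = 0) :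
    0 ≤ 3 * autocorr k w 0 - 4 * autocorr k w 1 + autocorr k w 2 := by
  have shift : ∀ f : ℕ → ℝ, f k = 0 →
      ∑ n ∈ Finset.range k, f (n + 1) = ∑ n ∈ Finset.range k, f n - f 0 := by
    intro f hf
    have h := (Finset.sum_range_succ' f k).symm.trans (Finset.sum_range_succ f k)
    linarith
  have hk := hw k le_rfl
  have hk1 := hw (k + 1) (by omega)
  have h1 := shift (fun n => w n ^ 2) (by simp [hk])
  have h2 := shift (fun n => w (n + 1) ^ 2) (by simp [hk1])
  have h3 := shift (fun n => w n * w (n + 1)) (by simp [hk])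
  have h0 : autocorr k w 0 = ∑ n ∈ Finset.range k, w n ^ 2 :=
    Finset.sum_congr rfl fun _ _ => by simp [sq]
  have hsq : 0 ≤ ∑ n ∈ Finset.range k, (w n - 2 * w (n + 1) + w (n + 1 + 1)) ^ 2 :=
    Finset.sum_nonneg fun _ _ => sq_nonneg _
  have he : ∑ n ∈ Finset.range k, (w n - 2 * w (n + 1) + w (n + 1 + 1)) ^ 2
      = ∑ n ∈ Finset.range k, w n ^ 2 + 4 * ∑ n ∈ Finset.range k, w (n + 1) ^ 2
        + ∑ n ∈ Finset.range k, w (n + 1 + 1) ^ 2 - 4 * autocorr k w 1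
        - 4 * ∑ n ∈ Finset.range k, w (n + 1) * w (n + 1 + 1) + 2 * autocorr k w 2 := by
    simp only [autocorr, Finset.mul_sum, ← Finset.sum_add_distrib, ← Finset.sum_sub_distrib]
    exact Finset.sum_congr rfl fun _ _ => by ring
  have h4 : autocorr k w 1 = ∑ n ∈ Finset.range k, w n * w (n + 1) := rfl
  simp only [zero_add] at h1 h2 h3
  nlinarith [sq_nonneg (w 0), sq_nonneg (w 1 - 2 * w 0)]

lemma sum_lamG_mul_autocorr_nonneg {α : ℝ} (hα : α ∈ Set.Ioo (0 : ℝ) 1) {k : ℕ} {w : ℕ → ℝ}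
    (hw : ∀ n, k ≤ n → w n = 0) :
    0 ≤ ∑ p ∈ Finset.range (k + 3), lamG α p * autocorr k w p := by
  have hC1 := autocorr_le_autocorr_zero hw 1
  have hC2 := autocorr_le_autocorr_zero hw 2
  have hD := autocorr_second_difference_nonneg hw
  have hC0 : 0 ≤ autocorr k w 0 :=
    Finset.sum_nonneg fun n _ => mul_self_nonneg (w n)
  have htail : (∑ p ∈ Finset.range k, lamG α (p + 3)) * autocorr k w 0
      ≤ ∑ p ∈ Finset.range k, lamG α (p + 3) * autocorr k w (p + 3) := by
    rw [Finset.sum_mul]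
    exact Finset.sum_le_sum fun p _ => mul_le_mul_of_nonpos_left
      (autocorr_le_autocorr_zero hw _) (lamG_add_three_nonpos hα p)
  have hsum : 0 ≤ ∑ p ∈ Finset.range (k + 3), lamG α p := by
    have h := sum_range_lamG α (k + 1)
    have hg := grunwaldG_succ_nonpos hα (k + 1)
    have hk : (0 : ℝ) ≤ k := k.cast_nonneg
    push_cast at h
    have hc : 0 ≤ (k : ℝ) + 1 + 1 - α - α ^ 2 / 2 := by nlinarith [hα.1, hα.2]
    have hle := mul_nonneg (neg_nonneg.2 hg) hc
    rw [← h] at hle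
    exact nonneg_of_mul_nonneg_right hle hα.1
  have hg1 : grunwaldG α 1 = -α := by
    have h := grunwaldG_succ α 0
    simp only [grunwaldG_zero, Nat.cast_zero, zero_add] at h
    linarith
  have hg2 : grunwaldG α 2 = α * (α - 1) / 2 := by
    have h := grunwaldG_succ α 1
    norm_num [hg1] at h
    linarith
  have hl1 : lamG α 1 = -(α * (3 + α) / 2) := by
    simp only [lamG, zero_add, hg1, grunwaldG_zero]
    ring
  have hl2 : lamG α 2 = α * (α ^ 2 + 3 * α - 2) / 4 := by
    simp only [lamG, Nat.reduceAdd, hg2, hg1]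
    ring
  obtain ⟨h0, h1⟩ := hα
  have hl1_nonpos : lamG α 1 ≤ 0 := by
    rw [hl1]
    have : 0 ≤ α * (3 + α) / 2 := by positivity
    linarith
  have hl12 : 4 * lamG α 2 ≤ -lamG α 1 := by
    rw [hl1, hl2]
    nlinarith [mul_nonneg h0.le (mul_nonneg (sub_nonneg.2 h1.le)
      (show 0 ≤ 2 * α + 7 by linarith))]
  have hlow : 0 ≤ -lamG α 1 * (autocorr k w 0 - autocorr k w 1)
      - lamG α 2 * (autocorr k w 0 - autocorr k w 2) := by
    rcases le_total (lamG α 2) 0 with h | h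
    · nlinarith [mul_nonneg (neg_nonneg.2 h) (sub_nonneg.2 hC2),
        mul_nonneg (neg_nonneg.2 hl1_nonpos) (sub_nonneg.2 hC1)]
    · nlinarith [mul_nonneg h hD, mul_nonneg (sub_nonneg.2 hl12) (sub_nonneg.2 hC1)]
  have hprod := mul_nonneg hsum hC0
  rw [Finset.sum_range_succ', Finset.sum_range_succ', Finset.sum_range_succ'] at hprod ⊢
  simp only [zero_add, add_assoc, Nat.reduceAdd] at hprod ⊢
  linarith

lemma sum_convolution_mul_eq_sum_autocorr (c v : ℕ → ℝ) (k : ℕ) :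
    ∑ n ∈ Finset.range k, (∑ p ∈ Finset.range (n + 1), c p * v (n + 1 - p)) * v (n + 1)
      = ∑ p ∈ Finset.range (k + 3),
          c p * autocorr k (fun n => if n < k then v (n + 1) else 0) p := by
  set w : ℕ → ℝ := fun n => if n < k then v (n + 1) else 0 with hw
  have hlag : ∀ p, autocorr k w p
      = ∑ m ∈ Finset.range k, if p ≤ m then v (m + 1 - p) * v (m + 1) else 0 := by
    intro p
    have h1 := Finset.sum_range_add (fun m => if p ≤ m then w (m - p) * w m else 0) p k
    have h2 := Finset.sum_range_add (fun m => if p ≤ m then w (m - p) * w m else 0) k p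
    have h3 : ∑ m ∈ Finset.range p, (if p ≤ m then w (m - p) * w m else 0) = 0 :=
      Finset.sum_eq_zero fun m hm => if_neg (by simpa using hm)
    have h4 : ∑ x ∈ Finset.range p,
        (if p ≤ k + x then w (k + x - p) * w (k + x) else 0) = 0 :=
      Finset.sum_eq_zero fun x _ => by simp [hw]
    have h5 : ∑ m ∈ Finset.range k, (if p ≤ m then w (m - p) * w m else 0)
        = ∑ m ∈ Finset.range k, if p ≤ m then v (m + 1 - p) * v (m + 1) else 0 := by
      refine Finset.sum_congr rfl fun m hm => ?_
      have hm' := Finset.mem_range.1 hm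
      split_ifs with hp
      · simp only [hw, if_pos hm', if_pos (show m - p < k by omega)]
        rw [show m - p + 1 = m + 1 - p by omega]
      · rfl
    simp only [le_add_iff_nonneg_right, zero_le, if_true, add_tsub_cancel_left] at h1
    rw [add_comm p k] at h1
    simp only [autocorr, add_comm _ p]
    linarith
  simp only [hlag, Finset.mul_sum]
  rw [Finset.sum_comm]
  refine Finset.sum_congr rfl fun n hn => ?_
  have hn' := Finset.mem_range.1 hn
  rw [Finset.sum_mul]
  have hsub : Finset.range (n + 1) ⊆ Finset.range (k + 3) :=
    Finset.range_subset_range.2 (by omega)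
  rw [← Finset.sum_subset hsub fun p _ hp => by
    rw [if_neg (by simpa [Nat.lt_succ_iff] using hp), mul_zero]]
  refine Finset.sum_congr rfl fun p hp => ?_
  rw [if_pos (Nat.lt_succ_iff.1 (Finset.mem_range.1 hp)), mul_assoc]

theorem quadratic_form_nonneg_sub (α : ℝ) (hα : α ∈ Set.Ioo (0 : ℝ) 1)
    (k : ℕ) (hk : 0 < k) (v : ℕ → ℝ) :
    0 ≤ ∑ n ∈ Finset.range k,
        (∑ p ∈ Finset.range (n + 1), lamG α p * v (n + 1 - p)) * v (n + 1) := by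
  rw [sum_convolution_mul_eq_sum_autocorr]
  exact sum_lamG_mul_autocorr_nonneg hα fun n hn => if_neg (by omega)
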